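/- (Theorem 2, relative error of the optimal estimation function.) For every ε > 0 and every n ∈ ℕ, the variance of the estimation value after n packet arrivals satisfies Σ_{l ∈ ℕ} Q_l(n)·(A_ε(l) − n)² = ε²·n²; consequently, for n ≥ 1 the root mean square relative error RMSRE[n] = √(Σ_{l} Q_l(n)·((A_ε(l) − n)/n)²) equals ε, independently of n. -/

import Mathlib

/-- The optimal estimation function `A_ε(l) = ((1+2ε²)^l − 1)(1+ε²)/(2ε²)`. -/
noncomputable def A (ε : ℝ) (l : ℕ) : ℝ :=
  ((1 + 2 * ε ^ 2) ^ l - 1) / (2 * ε ^ 2) * (1 + ε ^ 2)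

/-- `D_ε(l) = A_ε(l+1) − A_ε(l)`. -/
noncomputable def D (ε : ℝ) (l : ℕ) : ℝ := A ε (l + 1) - A ε l

/-- `Q ε n l` is the probability `Q_l(n)` that the counter's symbol equals `l`
after `n` packet arrivals, for the process that starts at symbol `0` and on
each arrival increments the current symbol `l` to `l+1` with probability
`1/D_ε(l)`. -/
noncomputable def Q (ε : ℝ) : ℕ → ℕ → ℝ
  | 0, 0 => 1
  | 0, _ + 1 => 0
  | n + 1, 0 => Q ε n 0 * (1 - 1 / D ε 0)
  | n + 1, l + 1 => Q ε n (l + 1) * (1 - 1 / D ε (l + 1)) + Q ε n l / D ε l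

theorem A_zero (ε : ℝ) : A ε 0 = 0 := by simp [A]

theorem D_eq {ε : ℝ} (hε : ε ≠ 0) (l : ℕ) :
    D ε l = 2 * ε ^ 2 * A ε l + (1 + ε ^ 2) := by
  unfold D A
  field_simp
  ring

theorem D_pos {ε : ℝ} (hε : ε ≠ 0) (l : ℕ) : 0 < D ε l := by
  have h : D ε l = (1 + 2 * ε ^ 2) ^ l * (1 + ε ^ 2) := by
    unfold D A
    field_simp
    ring
  rw [h]
  positivity

theorem Q_eq_zero_of_lt (ε : ℝ) {n l : ℕ} (h : n < l) : Q ε n l = 0 := by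
  induction n generalizing l with
  | zero =>
    obtain ⟨l, rfl⟩ := Nat.exists_eq_succ_of_ne_zero h.ne'
    rfl
  | succ n ih =>
    obtain ⟨l, rfl⟩ := Nat.exists_eq_succ_of_ne_zero (Nat.ne_zero_of_lt h)
    simp [Q, ih (show n < l by omega), ih (show n < l + 1 by omega)]

theorem tsum_Q_mul (ε : ℝ) (n : ℕ) (f : ℕ → ℝ) :
    ∑' l, Q ε n l * f l = ∑ l ∈ Finset.range (n + 1), Q ε n l * f l := by
  refine tsum_eq_sum fun l hl => ?_
  rw [Q_eq_zero_of_lt ε (by rw [Finset.mem_range] at hl; omega), zero_mul]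

theorem sum_range_Q_succ_mul (ε : ℝ) (n N : ℕ) (f : ℕ → ℝ) :
    ∑ l ∈ Finset.range (N + 1), Q ε (n + 1) l * f l =
      ∑ l ∈ Finset.range N, Q ε n l * (f l + (f (l + 1) - f l) / D ε l) +
        Q ε n N * (1 - 1 / D ε N) * f N := by
  induction N with
  | zero => simp [Q]
  | succ N ih =>
    rw [Finset.sum_range_succ, ih, Finset.sum_range_succ, Q]
    ring

/-- One-step evolution of the expectation of `f` under the distribution `Q ε n`. -/
theorem sum_Q_succ_mul (ε : ℝ) (n : ℕ) (f : ℕ → ℝ) :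
    ∑ l ∈ Finset.range (n + 1 + 1), Q ε (n + 1) l * f l =
      ∑ l ∈ Finset.range (n + 1), Q ε n l * (f l + (f (l + 1) - f l) / D ε l) := by
  rw [sum_range_Q_succ_mul, Q_eq_zero_of_lt ε n.lt_succ_self]
  ring

theorem sum_Q (ε : ℝ) (n : ℕ) : ∑ l ∈ Finset.range (n + 1), Q ε n l = 1 := by
  induction n with
  | zero => simp [Q]
  | succ n ih => simpa [ih] using sum_Q_succ_mul ε n fun _ => 1

theorem sum_Q_mul_A {ε : ℝ} (hε : ε ≠ 0) (n : ℕ) :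
    ∑ l ∈ Finset.range (n + 1), Q ε n l * A ε l = n := by
  induction n with
  | zero => simp [A_zero]
  | succ n ih =>
    have h (l : ℕ) : (A ε (l + 1) - A ε l) / D ε l = 1 := div_self (D_pos hε l).ne'
    simp only [sum_Q_succ_mul, h, mul_add, mul_one, Finset.sum_add_distrib, ih, sum_Q]
    push_cast
    rfl

theorem sum_Q_mul_A_sq {ε : ℝ} (hε : ε ≠ 0) (n : ℕ) :
    ∑ l ∈ Finset.range (n + 1), Q ε n l * A ε l ^ 2 = (1 + ε ^ 2) * (n : ℝ) ^ 2 := by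
  induction n with
  | zero => simp [A_zero]
  | succ n ih =>
    have h (l : ℕ) : Q ε n l * (A ε l ^ 2 + (A ε (l + 1) ^ 2 - A ε l ^ 2) / D ε l) =
        Q ε n l * A ε l ^ 2 + 2 * (1 + ε ^ 2) * (Q ε n l * A ε l) + (1 + ε ^ 2) * Q ε n l := by
      have hA : A ε (l + 1) = A ε l + D ε l := by unfold D; ring
      have hd : (A ε (l + 1) ^ 2 - A ε l ^ 2) / D ε l = 2 * A ε l + D ε l := by
        rw [div_eq_iff (D_pos hε l).ne', hA]
        ring
      rw [hd, D_eq hε]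
      ring
    rw [sum_Q_succ_mul ε n fun l => A ε l ^ 2]
    simp only [h, Finset.sum_add_distrib, ← Finset.mul_sum, ih, sum_Q_mul_A hε, sum_Q]
    push_cast
    ring

theorem tsum_Q_mul_A_sub_sq {ε : ℝ} (hε : ε ≠ 0) (n : ℕ) :
    ∑' l, Q ε n l * (A ε l - n) ^ 2 = ε ^ 2 * (n : ℝ) ^ 2 := by
  have h (l : ℕ) : Q ε n l * (A ε l - n) ^ 2 =
      Q ε n l * A ε l ^ 2 - 2 * n * (Q ε n l * A ε l) + (n : ℝ) ^ 2 * Q ε n l := by ring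
  rw [tsum_Q_mul ε n fun l => (A ε l - n) ^ 2]
  simp only [h, Finset.sum_add_distrib, Finset.sum_sub_distrib, ← Finset.mul_sum,
    sum_Q_mul_A_sq hε, sum_Q_mul_A hε, sum_Q]
  ring

/-- Theorem 2, relative error of the optimal estimation
function: the variance of the estimation value after `n` arrivals is
`Σ_l Q_l(n)·(A_ε(l) − n)² = ε²·n²`; consequently, for `n ≥ 1`, the root mean
square relative error `RMSRE[n] = √(Σ_l Q_l(n)·((A_ε(l) − n)/n)²)` equals `ε`,
independently of `n`. -/
theorem relative_error_optimal (ε : ℝ) (hε : ε > 0) (n : ℕ) :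
    (∑' l : ℕ, Q ε n l * (A ε l - n) ^ 2) = ε ^ 2 * (n : ℝ) ^ 2 ∧
    (1 ≤ n →
      Real.sqrt (∑' l : ℕ, Q ε n l * ((A ε l - n) / n) ^ 2) = ε) := by
  have hvar := tsum_Q_mul_A_sub_sq hε.ne' n
  refine ⟨hvar, fun hn => ?_⟩
  have hn' : (n : ℝ) ≠ 0 := by positivity
  simp only [div_pow, ← mul_div_assoc]
  rw [tsum_div_const, hvar, mul_div_cancel_right₀ _ (pow_ne_zero 2 hn'), Real.sqrt_sq hε.le]
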